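/- Define W'_∞ := {(z₁,z₂,z₃) ∈ ℂ³ : z₂ ≠ 0, z₃ ≠ 0, |z₁ − exp(i·log|z₂z₃|²)| < 1}. For z ∈ W'_∞ one has Re(z₁·exp(−i·log|z₂z₃|²)) > 0, so ℓ(z) := Log(z₁·exp(−i·log|z₂z₃|²)) + i·log|z₂z₃|² is well defined, where Log is the principal branch of the complex logarithm. Then: (i) ℓ is holomorphic on W'_∞ as a function of the three complex variables (z₁,z₂,z₃), and so is E_κ := exp(κ·ℓ) for every κ ∈ ℂ; (ii) for each (z₁,z₂,z₃) ∈ W'_∞, the complex derivative of ζ ↦ ℓ(ζ,z₂,z₃) at z₁ equals 1/z₁, while the complex derivative of ζ ↦ ℓ(z₁,ζ,z₃) at z₂ and the complex derivative of ζ ↦ ℓ(z₁,z₂,ζ) at z₃ both vanish. -/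

import Mathlib

open Complex

/-- `log|z₂z₃|²` as a real number. -/
noncomputable def Lofz (z : ℂ × ℂ × ℂ) : ℝ :=
  Real.log (‖z.2.1 * z.2.2‖ ^ 2)

/-- The unbounded worm `W'_∞`. -/
noncomputable def wormInfty : Set (ℂ × ℂ × ℂ) :=
  {z | z.2.1 ≠ 0 ∧ z.2.2 ≠ 0 ∧
    ‖z.1 - Complex.exp (Complex.I * (Lofz z : ℂ))‖ < 1}

/-- The holomorphic logarithm `ℓ` on `W'_∞`, defined via the principal branch `Log`. -/
noncomputable def ellfun (z : ℂ × ℂ × ℂ) : ℂ :=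
  Complex.log (z.1 * Complex.exp (-(Complex.I * (Lofz z : ℂ)))) + Complex.I * (Lofz z : ℂ)

open Filter Topology in
theorem ellfun_aux_pos (z : ℂ × ℂ × ℂ) (hz : z ∈ wormInfty) :
    0 < (z.1 * Complex.exp (-(Complex.I * (Lofz z : ℂ)))).re := by
  obtain ⟨_, _, h⟩ := hz
  have hn : ‖Complex.exp (-(Complex.I * (Lofz z : ℂ)))‖ = 1 := by
    rw [Complex.norm_exp]; simp
  have h1 : ‖z.1 * Complex.exp (-(Complex.I * (Lofz z : ℂ))) - 1‖ < 1 := by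
    have : z.1 * Complex.exp (-(Complex.I * (Lofz z : ℂ))) - 1 =
        (z.1 - Complex.exp (Complex.I * (Lofz z : ℂ))) *
          Complex.exp (-(Complex.I * (Lofz z : ℂ))) := by
      rw [sub_mul, ← Complex.exp_add]; simp
    rw [this, norm_mul, hn, mul_one]; exact h
  have h2 := (abs_lt.1 ((Complex.abs_re_le_norm _).trans_lt h1)).1
  rw [Complex.sub_re, Complex.one_re] at h2
  linarith

open Filter Topology in
theorem ellfun_aux_eq (z : ℂ × ℂ × ℂ) (hz : z ∈ wormInfty) :
    ∀ᶠ w in 𝓝 z, ellfun w =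
      Complex.log (w.1 * Complex.exp (-(Complex.I * (Lofz z : ℂ)))) +
        Complex.I * (Lofz z : ℂ) := by
  have hp := ellfun_aux_pos z hz
  obtain ⟨h2, h3, _⟩ := hz
  have hL : ContinuousAt Lofz z := by
    unfold Lofz
    refine ContinuousAt.log (by fun_prop) ?_
    simp [h2, h3]
  have e1 : ∀ᶠ w in 𝓝 z, |Lofz w - Lofz z| < Real.pi / 2 :=
    (Metric.tendsto_nhds.1 hL) (Real.pi / 2) (by positivity)
  have hc : ContinuousAt (fun w : ℂ × ℂ × ℂ =>
      (w.1 * Complex.exp (-(Complex.I * (Lofz z : ℂ)))).re) z := by fun_prop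
  have e2 := hc.eventually (lt_mem_nhds hp)
  filter_upwards [e1, e2] with w hw1 hw2
  unfold ellfun
  set a := w.1 * Complex.exp (-(Complex.I * (Lofz z : ℂ))) with ha
  have ha0 : a ≠ 0 := by
    intro h
    rw [h] at hw2
    simp at hw2
  have harg : |a.arg| < Real.pi / 2 := Complex.abs_arg_lt_pi_div_two_iff.2 (Or.inl hw2)
  have key : w.1 * Complex.exp (-(Complex.I * (Lofz w : ℂ))) =
      Complex.exp (Complex.log a - Complex.I * ((Lofz w - Lofz z : ℝ) : ℂ)) := by
    rw [Complex.exp_sub, Complex.exp_log ha0, ha, div_eq_mul_inv, ← Complex.exp_neg,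
      mul_assoc, ← Complex.exp_add]
    congr 2
    push_cast
    ring
  rw [abs_lt] at harg hw1
  have him : (Complex.log a - Complex.I * ((Lofz w - Lofz z : ℝ) : ℂ)).im =
      a.arg - (Lofz w - Lofz z) := by
    rw [Complex.sub_im, Complex.log_im, Complex.I_mul_im, Complex.ofReal_re]
  rw [key, Complex.log_exp (by rw [him]; linarith) (by rw [him]; linarith)]
  push_cast
  ring

theorem ellfun_aux_diff (z : ℂ × ℂ × ℂ) (hz : z ∈ wormInfty) :
    DifferentiableAt ℂ ellfun z := by
  have h : DifferentiableAt ℂ (fun w : ℂ × ℂ × ℂ =>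
      Complex.log (w.1 * Complex.exp (-(Complex.I * (Lofz z : ℂ)))) +
        Complex.I * (Lofz z : ℂ)) z := by
    refine DifferentiableAt.add_const _ (DifferentiableAt.clog (by fun_prop) ?_)
    exact Or.inl (ellfun_aux_pos z hz)
  exact h.congr_of_eventuallyEq (ellfun_aux_eq z hz)

/-- On `W'_∞` one has `Re(z₁e^{−i log|z₂z₃|²}) > 0`, the function `ℓ` is holomorphic,
as is `E_κ = exp(κℓ)` for every `κ ∈ ℂ`; moreover the complex partial derivative of `ℓ`
in `z₁` is `1/z₁` while its complex partial derivatives in `z₂` and `z₃` vanish. -/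
theorem ellfun_holomorphic :
    (∀ z ∈ wormInfty, 0 < (z.1 * Complex.exp (-(Complex.I * (Lofz z : ℂ)))).re) ∧
    DifferentiableOn ℂ ellfun wormInfty ∧
    (∀ κ : ℂ, DifferentiableOn ℂ (fun z => Complex.exp (κ * ellfun z)) wormInfty) ∧
    (∀ z ∈ wormInfty,
      HasDerivAt (fun ζ : ℂ => ellfun (ζ, z.2.1, z.2.2)) (1 / z.1) z.1 ∧
      HasDerivAt (fun ζ : ℂ => ellfun (z.1, ζ, z.2.2)) 0 z.2.1 ∧
      HasDerivAt (fun ζ : ℂ => ellfun (z.1, z.2.1, ζ)) 0 z.2.2) := by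
  refine ⟨ellfun_aux_pos, fun z hz => (ellfun_aux_diff z hz).differentiableWithinAt,
    fun κ z hz => (((ellfun_aux_diff z hz).const_mul κ).cexp).differentiableWithinAt, ?_⟩
  intro z hz
  have hp := ellfun_aux_pos z hz
  have he := ellfun_aux_eq z hz
  refine ⟨?_, ?_, ?_⟩
  · have hc : ContinuousAt (fun ζ : ℂ => ((ζ, z.2.1, z.2.2) : ℂ × ℂ × ℂ)) z.1 := by fun_prop
    have hd : HasDerivAt (fun ζ : ℂ =>
        Complex.log (ζ * Complex.exp (-(Complex.I * (Lofz z : ℂ)))) +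
          Complex.I * (Lofz z : ℂ)) (1 / z.1) z.1 := by
      have h0 : z.1 ≠ 0 := by
        intro h
        rw [h] at hp
        simp at hp
      have h1 := (((hasDerivAt_id z.1).mul_const
        (Complex.exp (-(Complex.I * (Lofz z : ℂ))))).clog (Or.inl hp)).add_const
          (Complex.I * (Lofz z : ℂ))
      refine h1.congr_deriv ?_
      have := Complex.exp_ne_zero (-(Complex.I * (Lofz z : ℂ)))
      simp only [id]
      field_simp
    exact hd.congr_of_eventuallyEq (hc.eventually he)
  · have hc : ContinuousAt (fun ζ : ℂ => ((z.1, ζ, z.2.2) : ℂ × ℂ × ℂ)) z.2.1 := by fun_prop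
    exact (hasDerivAt_const z.2.1 (Complex.log (z.1 * Complex.exp (-(Complex.I * (Lofz z : ℂ)))) +
      Complex.I * (Lofz z : ℂ))).congr_of_eventuallyEq (hc.eventually he)
  · have hc : ContinuousAt (fun ζ : ℂ => ((z.1, z.2.1, ζ) : ℂ × ℂ × ℂ)) z.2.2 := by fun_prop
    exact (hasDerivAt_const z.2.2 (Complex.log (z.1 * Complex.exp (-(Complex.I * (Lofz z : ℂ)))) +
      Complex.I * (Lofz z : ℂ))).congr_of_eventuallyEq (hc.eventually he)
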